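/- arXiv:1809.09440 — 2 statements merged into one kernel-verified Lean document; each statement's English description precedes it below -/
import Mathlib

section
/- Let u₁, u₂, u₃ ∈ ℂ with Re uᵢ > 1 for i = 1,2,3. Then ∫₀¹ ζ₁(u₁,α) ζ₁(u₂,α) ζ₁(u₃,α) dα = 1/(u₁+u₂+u₃−1) + ∫₁^∞ α^{−u₁} ζ₁(u₂,α) ζ₁(u₃,α) dα + ∫₁^∞ α^{−u₂} ζ₁(u₁,α) ζ₁(u₃,α) dα + ∫₁^∞ α^{−u₃} ζ₁(u₁,α) ζ₁(u₂,α) dα + ∫₁^∞ α^{−u₁−u₂} ζ₁(u₃,α) dα + ∫₁^∞ α^{−u₂−u₃} ζ₁(u₁,α) dα + ∫₁^∞ α^{−u₃−u₁} ζ₁(u₂,α) dα. -/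
open Complex MeasureTheory Real

/-- The modified Hurwitz zeta function `ζ₁(s, α) = ∑_{n=1}^∞ (n+α)^{-s}`,
as an absolutely convergent series (valid for `Re s > 1`, `α > 0`). -/
noncomputable def zeta1 (s : ℂ) (α : ℝ) : ℂ := ∑' n : ℕ, (((n : ℂ) + 1) + (α : ℂ)) ^ (-s)

lemma norm_zeta1_term (s : ℂ) (n : ℕ) {α : ℝ} (hα : 0 ≤ α) :
    ‖(((n : ℂ) + 1) + (α : ℂ)) ^ (-s)‖ = ((n : ℝ) + 1 + α) ^ (-s.re) := by
  have hpos : (0 : ℝ) < (n : ℝ) + 1 + α := by positivity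
  have h := Complex.norm_cpow_eq_rpow_re_of_pos hpos (-s)
  simpa using h

lemma norm_zeta1_term_le {s : ℂ} (hs : 1 < s.re) (n : ℕ) {α : ℝ} (hα : 0 ≤ α) :
    ‖(((n : ℂ) + 1) + (α : ℂ)) ^ (-s)‖ ≤ ((n : ℝ) + 1) ^ (-s.re) := by
  rw [norm_zeta1_term s n hα]
  exact Real.rpow_le_rpow_of_nonpos (by positivity) (by linarith) (by linarith)

lemma summable_nat_add_one_rpow_neg {σ : ℝ} (hσ : 1 < σ) :
    Summable fun n : ℕ ↦ ((n : ℝ) + 1) ^ (-σ) := by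
  have h := (summable_nat_add_iff 1).mpr (Real.summable_nat_rpow.mpr (by linarith : -σ < -1))
  simpa using h

lemma summable_zeta1_term {s : ℂ} (hs : 1 < s.re) {α : ℝ} (hα : 0 ≤ α) :
    Summable fun n : ℕ ↦ (((n : ℂ) + 1) + (α : ℂ)) ^ (-s) :=
  .of_norm_bounded (summable_nat_add_one_rpow_neg hs) fun n ↦ norm_zeta1_term_le hs n hα

lemma continuousOn_zeta1 {s : ℂ} (hs : 1 < s.re) : ContinuousOn (zeta1 s) (Set.Ici 0) := by
  refine continuousOn_tsum (fun n α hα ↦ ?_) (summable_nat_add_one_rpow_neg hs)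
    fun n α hα ↦ norm_zeta1_term_le hs n hα
  have hα' : 0 ≤ α := hα
  refine ContinuousAt.continuousWithinAt (ContinuousAt.cpow (by fun_prop) continuousAt_const (Or.inl ?_))
  have : (0 : ℝ) < (n : ℝ) + 1 + α := by positivity
  simpa using this

lemma zeta1_sub_one {s : ℂ} (hs : 1 < s.re) {α : ℝ} (hα : 1 ≤ α) :
    zeta1 s (α - 1) = (α : ℂ) ^ (-s) + zeta1 s α := by
  unfold zeta1
  rw [(summable_zeta1_term hs (sub_nonneg.mpr hα)).tsum_eq_zero_add]
  congr 1
  · push_cast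
    ring_nf
  · refine tsum_congr fun n ↦ ?_
    push_cast
    ring_nf

lemma norm_zeta1_le {s : ℂ} (hs : 1 < s.re) {α : ℝ} (hα : 0 < α) :
    ‖zeta1 s α‖ ≤ 1 / (s.re - 1) * α ^ (1 - s.re) := by
  have hsum := (summable_nat_add_one_rpow_neg hs).of_norm_bounded
    (fun n ↦ (norm_norm _).trans_le (norm_zeta1_term_le hs n hα.le))
  refine (norm_tsum_le_tsum_norm hsum).trans (hsum.tsum_le_of_sum_range_le fun N ↦ ?_)
  have hanti : AntitoneOn (fun x : ℝ ↦ x ^ (-s.re)) (Set.Icc α (α + N)) := fun x hx y _ hxy ↦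
    Real.rpow_le_rpow_of_nonpos (hα.trans_le hx.1) hxy (by linarith)
  have hInt := hanti.sum_le_integral
  rw [integral_rpow (Or.inr ⟨by linarith, Set.notMem_uIcc_of_lt hα (by positivity)⟩)] at hInt
  calc ∑ n ∈ Finset.range N, ‖(((n : ℂ) + 1) + (α : ℂ)) ^ (-s)‖
      = ∑ n ∈ Finset.range N, (α + ((n + 1 : ℕ) : ℝ)) ^ (-s.re) := by
        refine Finset.sum_congr rfl fun n _ ↦ ?_
        rw [norm_zeta1_term s n hα.le]
        push_cast
        ring_nf
    _ ≤ ((α + N) ^ (-s.re + 1) - α ^ (-s.re + 1)) / (-s.re + 1) := hInt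
    _ = 1 / (s.re - 1) * (α ^ (1 - s.re) - (α + N) ^ (1 - s.re)) := by
        have h₁ : -s.re + 1 ≠ 0 := by linarith
        have h₂ : s.re - 1 ≠ 0 := by linarith
        rw [show (1 : ℝ) - s.re = -s.re + 1 by ring]
        field_simp
        ring
    _ ≤ 1 / (s.re - 1) * α ^ (1 - s.re) := by
        have h₂ : 0 < s.re - 1 := by linarith
        gcongr
        exact sub_le_self _ (by positivity)

lemma tendsto_zeta1_atTop {s : ℂ} (hs : 1 < s.re) :
    Filter.Tendsto (zeta1 s) Filter.atTop (nhds 0) := by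
  have h := (tendsto_rpow_neg_atTop (by linarith : 0 < s.re - 1)).const_mul (1 / (s.re - 1))
  rw [mul_zero] at h
  refine squeeze_zero_norm' ?_ h
  filter_upwards [Filter.eventually_gt_atTop 0] with α hα
  simpa only [neg_sub] using norm_zeta1_le hs hα

lemma integrableOn_Ioi_one_of_norm_le_rpow {f : ℝ → ℂ} {C p : ℝ} (hp : p < -1)
    (hf : ContinuousOn f (Set.Ioi 1)) (hle : ∀ x, 1 < x → ‖f x‖ ≤ C * x ^ p) :
    IntegrableOn f (Set.Ioi 1) :=
  ((integrableOn_Ioi_rpow_of_lt hp one_pos).const_mul C).mono'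
    (hf.aestronglyMeasurable measurableSet_Ioi)
    ((ae_restrict_iff' measurableSet_Ioi).mpr (.of_forall hle))

lemma continuousOn_ofReal_cpow (s : ℂ) :
    ContinuousOn (fun α : ℝ ↦ (α : ℂ) ^ s) (Set.Ioi 1) := fun α hα ↦
  ContinuousAt.continuousWithinAt <| Complex.continuousAt_ofReal_cpow_const α s
    (Or.inr (zero_lt_one.trans hα).ne')

lemma Ioi_one_subset_Ici_zero : Set.Ioi (1 : ℝ) ⊆ Set.Ici 0 :=
  Set.Ioi_subset_Ici zero_le_one

lemma integrableOn_cpow_mul_zeta1 {w s : ℂ} (hs : 1 < s.re) (hws : 2 < w.re + s.re) :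
    IntegrableOn (fun α : ℝ ↦ (α : ℂ) ^ (-w) * zeta1 s α) (Set.Ioi 1) := by
  refine integrableOn_Ioi_one_of_norm_le_rpow (C := 1 / (s.re - 1)) (p := -w.re + (1 - s.re))
    (by linarith)
    ((continuousOn_ofReal_cpow _).mul ((continuousOn_zeta1 hs).mono Ioi_one_subset_Ici_zero))
    fun x hx ↦ ?_
  have hx0 : 0 < x := by linarith
  rw [norm_mul, Complex.norm_cpow_eq_rpow_re_of_pos hx0, Complex.neg_re, Real.rpow_add hx0,
    mul_left_comm]
  gcongr
  exact norm_zeta1_le hs hx0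

lemma integrableOn_cpow_mul_zeta1_mul_zeta1 {w s t : ℂ} (hs : 1 < s.re) (ht : 1 < t.re)
    (hwst : 3 < w.re + s.re + t.re) :
    IntegrableOn (fun α : ℝ ↦ (α : ℂ) ^ (-w) * zeta1 s α * zeta1 t α) (Set.Ioi 1) := by
  refine integrableOn_Ioi_one_of_norm_le_rpow (C := 1 / (s.re - 1) * (1 / (t.re - 1)))
    (p := -w.re + (1 - s.re) + (1 - t.re)) (by linarith)
    (((continuousOn_ofReal_cpow _).mul ((continuousOn_zeta1 hs).mono Ioi_one_subset_Ici_zero)).mul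
      ((continuousOn_zeta1 ht).mono Ioi_one_subset_Ici_zero))
    fun x hx ↦ ?_
  have hx0 : 0 < x := by linarith
  rw [norm_mul, norm_mul, Complex.norm_cpow_eq_rpow_re_of_pos hx0, Complex.neg_re]
  calc x ^ (-w.re) * ‖zeta1 s x‖ * ‖zeta1 t x‖
      ≤ x ^ (-w.re) * (1 / (s.re - 1) * x ^ (1 - s.re)) * (1 / (t.re - 1) * x ^ (1 - t.re)) := by
        have : 0 < s.re - 1 := by linarith
        gcongr
        · exact norm_zeta1_le hs hx0
        · exact norm_zeta1_le ht hx0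
    _ = _ := by
        rw [Real.rpow_add hx0, Real.rpow_add hx0]
        ring

/-- A telescoping principle: if `F` is continuous on `[0, ∞)` and vanishes at infinity, the
integral over `(1, ∞)` of the backward difference of `F` is the integral of `F` over `[0, 1]`. -/
lemma integral_Ioi_one_sub_eq {F : ℝ → ℂ} (hF : ContinuousOn F (Set.Ici 0))
    (hlim : Filter.Tendsto F Filter.atTop (nhds 0))
    (hInt : IntegrableOn (fun α ↦ F (α - 1) - F α) (Set.Ioi 1)) :
    ∫ α in Set.Ioi (1 : ℝ), (F (α - 1) - F α) = ∫ α in (0 : ℝ)..1, F α := by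
  have hii : ∀ {a b : ℝ}, 0 ≤ a → 0 ≤ b → IntervalIntegrable F volume a b := fun ha hb ↦
    (hF.mono fun x hx ↦ (le_min ha hb).trans hx.1).intervalIntegrable
  have hlast : Filter.Tendsto (fun T : ℝ ↦ ∫ α in (T - 1)..T, F α) Filter.atTop (nhds 0) := by
    rw [Metric.tendsto_atTop] at hlim ⊢
    intro ε hε
    obtain ⟨N, hN⟩ := hlim (ε / 2) (half_pos hε)
    refine ⟨N + 1, fun T hT ↦ ?_⟩
    have hle := intervalIntegral.norm_integral_le_of_norm_le_const (a := T - 1) (b := T)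
      (f := F) (C := ε / 2) fun x hx ↦ by
        rw [Set.uIoc_of_le (by linarith)] at hx
        simpa using (hN x (by linarith [hx.1])).le
    rw [dist_zero_right]
    simp only [sub_sub_cancel, abs_one, mul_one] at hle
    linarith
  have hpartial : ∀ᶠ T : ℝ in Filter.atTop, (∫ α in (0 : ℝ)..1, F α) - ∫ α in (T - 1)..T, F α =
      ∫ α in (1 : ℝ)..T, (F (α - 1) - F α) := by
    filter_upwards [Filter.eventually_ge_atTop 1] with T hT
    have hT' : 0 ≤ T - 1 := by linarith
    have hshift : IntervalIntegrable (fun α ↦ F (α - 1)) volume 1 T := by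
      simpa using (hii le_rfl hT').comp_sub_right 1
    rw [intervalIntegral.integral_sub hshift (hii zero_le_one (by linarith)),
      intervalIntegral.integral_comp_sub_right (fun α ↦ F α), sub_self,
      ← intervalIntegral.integral_add_adjacent_intervals (hii le_rfl hT')
        (hii hT' zero_le_one),
      ← intervalIntegral.integral_add_adjacent_intervals (hii zero_le_one hT')
        (hii hT' (by linarith : (0 : ℝ) ≤ T)),
      intervalIntegral.integral_symm 1 (T - 1)]
    ring
  refine tendsto_nhds_unique
    (intervalIntegral_tendsto_integral_Ioi 1 hInt Filter.tendsto_id) ?_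
  refine Filter.Tendsto.congr' hpartial ?_
  simpa using (tendsto_const_nhds (x := ∫ α in (0 : ℝ)..1, F α)).sub hlast

theorem stmt_9 (u₁ u₂ u₃ : ℂ) (h₁ : 1 < u₁.re) (h₂ : 1 < u₂.re) (h₃ : 1 < u₃.re) :
    ∫ α in (0 : ℝ)..1, zeta1 u₁ α * zeta1 u₂ α * zeta1 u₃ α =
      1 / (u₁ + u₂ + u₃ - 1)
        + (∫ α in Set.Ioi (1 : ℝ), (α : ℂ) ^ (-u₁) * zeta1 u₂ α * zeta1 u₃ α)
        + (∫ α in Set.Ioi (1 : ℝ), (α : ℂ) ^ (-u₂) * zeta1 u₁ α * zeta1 u₃ α)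
        + (∫ α in Set.Ioi (1 : ℝ), (α : ℂ) ^ (-u₃) * zeta1 u₁ α * zeta1 u₂ α)
        + (∫ α in Set.Ioi (1 : ℝ), (α : ℂ) ^ (-u₁ - u₂) * zeta1 u₃ α)
        + (∫ α in Set.Ioi (1 : ℝ), (α : ℂ) ^ (-u₂ - u₃) * zeta1 u₁ α)
        + ∫ α in Set.Ioi (1 : ℝ), (α : ℂ) ^ (-u₃ - u₁) * zeta1 u₂ α := by
  have hre : (-u₁ - u₂ - u₃).re < -1 := by
    simp only [Complex.sub_re, Complex.neg_re]
    linarith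
  have i₀ : IntegrableOn (fun α : ℝ ↦ (α : ℂ) ^ (-u₁ - u₂ - u₃)) (Set.Ioi 1) :=
    integrableOn_Ioi_cpow_of_lt hre one_pos
  have i₁ := integrableOn_cpow_mul_zeta1_mul_zeta1 (w := u₁) h₂ h₃ (by linarith)
  have i₂ := integrableOn_cpow_mul_zeta1_mul_zeta1 (w := u₂) h₁ h₃ (by linarith)
  have i₃ := integrableOn_cpow_mul_zeta1_mul_zeta1 (w := u₃) h₁ h₂ (by linarith)
  have i₁₂ := integrableOn_cpow_mul_zeta1 (w := u₁ + u₂) h₃ (by rw [Complex.add_re]; linarith)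
  have i₂₃ := integrableOn_cpow_mul_zeta1 (w := u₂ + u₃) h₁ (by rw [Complex.add_re]; linarith)
  have i₃₁ := integrableOn_cpow_mul_zeta1 (w := u₃ + u₁) h₂ (by rw [Complex.add_re]; linarith)
  rw [neg_add'] at i₁₂ i₂₃ i₃₁
  have hval : ∫ α in Set.Ioi (1 : ℝ), (α : ℂ) ^ (-u₁ - u₂ - u₃) = 1 / (u₁ + u₂ + u₃ - 1) := by
    rw [integral_Ioi_cpow_of_lt hre one_pos, Complex.ofReal_one, Complex.one_cpow, neg_div,
      ← div_neg]
    ring_nf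
  have hdiff : Set.EqOn
      (fun α : ℝ ↦ zeta1 u₁ (α - 1) * zeta1 u₂ (α - 1) * zeta1 u₃ (α - 1)
        - zeta1 u₁ α * zeta1 u₂ α * zeta1 u₃ α)
      (fun α : ℝ ↦ (α : ℂ) ^ (-u₁ - u₂ - u₃)
        + (α : ℂ) ^ (-u₁) * zeta1 u₂ α * zeta1 u₃ α
        + (α : ℂ) ^ (-u₂) * zeta1 u₁ α * zeta1 u₃ α
        + (α : ℂ) ^ (-u₃) * zeta1 u₁ α * zeta1 u₂ α
        + (α : ℂ) ^ (-u₁ - u₂) * zeta1 u₃ α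
        + (α : ℂ) ^ (-u₂ - u₃) * zeta1 u₁ α
        + (α : ℂ) ^ (-u₃ - u₁) * zeta1 u₂ α) (Set.Ioi 1) := by
    intro α hα
    have hα1 : 1 < α := hα
    have hα0 : (α : ℂ) ≠ 0 := by exact_mod_cast (zero_lt_one.trans hα1).ne'
    simp only [zeta1_sub_one h₁ hα1.le, zeta1_sub_one h₂ hα1.le, zeta1_sub_one h₃ hα1.le,
      sub_eq_add_neg (-u₁), sub_eq_add_neg (-u₂), sub_eq_add_neg (-u₃),
      sub_eq_add_neg (-u₁ + -u₂), Complex.cpow_add _ _ hα0]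
    ring
  have hInt := (((((i₀.add i₁).add i₂).add i₃).add i₁₂).add i₂₃).add i₃₁
  rw [← integral_Ioi_one_sub_eq
      (F := fun α ↦ zeta1 u₁ α * zeta1 u₂ α * zeta1 u₃ α)
      (((continuousOn_zeta1 h₁).mul (continuousOn_zeta1 h₂)).mul (continuousOn_zeta1 h₃))
      (by
        simpa using
          ((tendsto_zeta1_atTop h₁).mul (tendsto_zeta1_atTop h₂)).mul (tendsto_zeta1_atTop h₃))
      (hInt.congr_fun hdiff.symm measurableSet_Ioi),
    setIntegral_congr_fun measurableSet_Ioi hdiff, ← hval,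
    ← integral_add' i₀ i₁, ← integral_add' (i₀.add i₁) i₂,
    ← integral_add' ((i₀.add i₁).add i₂) i₃,
    ← integral_add' (((i₀.add i₁).add i₂).add i₃) i₁₂,
    ← integral_add' ((((i₀.add i₁).add i₂).add i₃).add i₁₂) i₂₃,
    ← integral_add' (((((i₀.add i₁).add i₂).add i₃).add i₁₂).add i₂₃) i₃₁]
  rfl
end

section
/- Let u, v ∈ ℂ with Re u > 1 and Re v < 1. Then ∫₀¹ α^{−v} ζ₁(u,α) dα = (ζ(u)−1)/(1−v) + (u/(1−v)) ∫₀¹ α^{1−v} ζ₁(u+1,α) dα. -/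
open Complex MeasureTheory Real

theorem summable_zeta1 {s : ℂ} (hs : 1 < s.re) {α : ℝ} (hα : -1 < α) :
    Summable fun n : ℕ => (((n : ℂ) + 1) + (α : ℂ)) ^ (-s) := by
  refine .of_norm (((Real.summable_one_div_nat_add_rpow (1 + α) s.re).mpr hs).congr fun n => ?_)
  have hpos : 0 < (n : ℝ) + (1 + α) := by
    have : (0 : ℝ) ≤ n := n.cast_nonneg
    linarith
  rw [show ((n : ℂ) + 1) + (α : ℂ) = (((n : ℝ) + (1 + α) : ℝ) : ℂ) by push_cast; ring,
    Complex.norm_cpow_eq_rpow_re_of_pos hpos, abs_of_pos hpos, Complex.neg_re,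
    Real.rpow_neg hpos.le, one_div]

theorem hasDerivAt_zeta1 {s : ℂ} (hs : 1 < s.re) {α : ℝ} (hα : -1 < α) :
    HasDerivAt (zeta1 s) (-s * zeta1 (s + 1) α) α := by
  obtain ⟨b, hb, hbα⟩ := exists_between hα
  have hsum : Summable fun n : ℕ => ‖s‖ * (1 / |(n : ℝ) + (1 + b)| ^ (s.re + 1)) :=
    ((Real.summable_one_div_nat_add_rpow (1 + b) (s.re + 1)).mpr (by linarith)).mul_left _
  have key := hasDerivAt_tsum_of_isPreconnected hsum (t := Set.Ioi b)
    (g := fun (n : ℕ) (y : ℝ) => (((n : ℂ) + 1) + (y : ℂ)) ^ (-s))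
    (g' := fun (n : ℕ) (y : ℝ) => -s * (((n : ℂ) + 1) + (y : ℂ)) ^ (-(s + 1)))
    isOpen_Ioi isPreconnected_Ioi (fun n y hy => ?_) (fun n y hy => ?_) hbα
    (summable_zeta1 hs hα) hbα
  · rw [tsum_mul_left] at key
    exact key
  · have hpos : 0 < (n : ℝ) + 1 + y := by
      have : (0 : ℝ) ≤ n := n.cast_nonneg
      linarith [Set.mem_Ioi.mp hy]
    have hslit : ((n : ℂ) + 1) + (y : ℂ) ∈ Complex.slitPlane := by
      left
      simpa using hpos
    have h := (((hasDerivAt_id (y : ℂ)).const_add ((n : ℂ) + 1)).cpow_const (c := -s)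
      hslit).comp_ofReal
    simpa [neg_add, sub_eq_add_neg, add_comm] using h
  · have hn : (0 : ℝ) ≤ n := n.cast_nonneg
    have hy' := Set.mem_Ioi.mp hy
    have hpos : 0 < (n : ℝ) + (1 + y) := by linarith
    have hposb : 0 < (n : ℝ) + (1 + b) := by linarith
    rw [show ((n : ℂ) + 1) + (y : ℂ) = (((n : ℝ) + (1 + y) : ℝ) : ℂ) by push_cast; ring,
      norm_mul, norm_neg, Complex.norm_cpow_eq_rpow_re_of_pos hpos, abs_of_pos hposb,
      one_div, ← Real.rpow_neg hposb.le]
    gcongr ‖s‖ * ?_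
    exact Real.rpow_le_rpow_of_nonpos hposb (by linarith)
      (by simp only [Complex.neg_re, Complex.add_re, Complex.one_re]; linarith)

theorem zeta1_one {s : ℂ} (hs : 1 < s.re) : zeta1 s 1 = riemannZeta s - 1 := by
  have h0 := summable_zeta1 hs (α := 0) (by norm_num)
  have h1 := h0.tsum_eq_zero_add
  rw [zeta_eq_tsum_one_div_nat_add_one_cpow hs]
  simp only [one_div, ← Complex.cpow_neg]
  simp only [Complex.ofReal_zero, add_zero, Nat.cast_zero, zero_add, Complex.one_cpow,
    Nat.cast_add, Nat.cast_one] at h1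
  rw [h1, zeta1, Complex.ofReal_one]
  ring

theorem stmt_12 (u v : ℂ) (hu : 1 < u.re) (hv : v.re < 1) :
    ∫ α in (0 : ℝ)..1, (α : ℂ) ^ (-v) * zeta1 u α =
      (riemannZeta u - 1) / (1 - v)
        + (u / (1 - v)) * ∫ α in (0 : ℝ)..1, (α : ℂ) ^ (1 - v) * zeta1 (u + 1) α := by
  have hre : 0 < (1 - v).re := by simpa using hv
  have hne : 1 - v ≠ 0 := fun h => by simp [h] at hre
  have hderiv : ∀ {s : ℂ}, 1 < s.re → ∀ x ∈ Set.uIcc (0 : ℝ) 1,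
      HasDerivAt (zeta1 s) (-s * zeta1 (s + 1) x) x := fun hs x hx => by
    rw [Set.uIcc_of_le zero_le_one] at hx
    exact hasDerivAt_zeta1 hs (by linarith [hx.1])
  have hcont : ∀ {s : ℂ}, 1 < s.re → ContinuousOn (zeta1 s) (Set.uIcc (0 : ℝ) 1) :=
    fun hs x hx => (hderiv hs x hx).continuousAt.continuousWithinAt
  have hu1 : 1 < (u + 1).re := by
    simp only [Complex.add_re, Complex.one_re]
    linarith
  have parts := intervalIntegral.integral_mul_deriv_eq_deriv_mul_of_hasDerivAt
    (a := 0) (b := 1) (u := zeta1 u) (u' := fun x => -u * zeta1 (u + 1) x)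
    (v := fun x : ℝ => (x : ℂ) ^ (1 - v)) (v' := fun x : ℝ => (1 - v) * (x : ℂ) ^ (-v))
    (hcont hu) (Complex.continuous_ofReal_cpow_const hre).continuousOn
    (fun x hx => hderiv hu x (Set.Ioo_subset_Icc_self hx))
    (fun x hx => by
      rw [min_eq_left zero_le_one] at hx
      simpa using hasDerivAt_ofReal_cpow_const hx.1.ne' hne)
    ((hcont hu1).const_mul (-u)).intervalIntegrable
    ((intervalIntegral.intervalIntegrable_cpow' (by simpa using hv)).const_mul _)
  have hl : ∫ x in (0 : ℝ)..1, zeta1 u x * ((1 - v) * (x : ℂ) ^ (-v)) =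
      (1 - v) * ∫ x in (0 : ℝ)..1, (x : ℂ) ^ (-v) * zeta1 u x := by
    rw [← intervalIntegral.integral_const_mul]
    congr 1 with x
    ring
  have hr : ∫ x in (0 : ℝ)..1, -u * zeta1 (u + 1) x * (x : ℂ) ^ (1 - v) =
      -u * ∫ x in (0 : ℝ)..1, (x : ℂ) ^ (1 - v) * zeta1 (u + 1) x := by
    rw [← intervalIntegral.integral_const_mul]
    congr 1 with x
    ring
  rw [hl, hr, zeta1_one hu, Complex.ofReal_one, Complex.one_cpow, Complex.ofReal_zero,
    Complex.zero_cpow hne] at parts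
  rw [div_mul_eq_mul_div, ← add_div, eq_div_iff hne, mul_comm, parts]
  ring
end
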